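/- There exists N such that the following holds for all n ≥ N. Let G be an (r_G/n)-pseudorandom graph on n vertices with r_G ≥ 2(log n)², and let H be a spanning subgraph of G with δ(H) ≥ (29/30)·r_G. Let P be a perfect matching (if n is even) or a perfect pseudomatching (if n is odd) on V(G) which is edge-disjoint from H. Then H contains a matching P' such that the union P ∪ P' is a 2-regular graph on V(G) with at most 3n√(r_G·log n)/δ(H) cycles. -/

import Mathlib

open scoped Classical
open SimpleGraph

namespace EDHC

/-- Degree of a vertex (as cardinality of its neighbour set). -/
noncomputable def deg {V : Type} (G : SimpleGraph V) (v : V) : ℕ := (G.neighborSet v).ncard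

/-- Minimum degree. -/
noncomputable def minDeg {V : Type} (G : SimpleGraph V) : ℕ := sInf (Set.range (deg G))

/-- Maximum degree. -/
noncomputable def maxDeg {V : Type} (G : SimpleGraph V) : ℕ := sSup (Set.range (deg G))

/-- Number of edges of `G` with both endpoints in `S`. -/
noncomputable def eIn {V : Type} (G : SimpleGraph V) (S : Set V) : ℕ :=
  {e ∈ G.edgeSet | ∀ v ∈ e, v ∈ S}.ncard

/-- Number of edges of `G` with one endpoint in `S` and the other in `T`. -/
noncomputable def eBtw {V : Type} (G : SimpleGraph V) (S T : Set V) : ℕ :=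
  {e ∈ G.edgeSet | ∃ a ∈ S, ∃ b ∈ T, e = s(a, b)}.ncard

/-- `G` is `(p, β)`-jumbled. -/
def IsJumbled {V : Type} (G : SimpleGraph V) (p β : ℝ) : Prop :=
  ∀ S : Set V, |(eIn G S : ℝ) - p * ((S.ncard : ℝ) * ((S.ncard : ℝ) - 1) / 2)| ≤ β * S.ncard

/-- `G` is strongly `2`-jumping. -/
def StronglyTwoJumping (n : ℕ) (G : SimpleGraph (Fin n)) : Prop :=
  ∀ T : Set (Fin n), T.Nonempty →
    (∑ v ∈ (Set.toFinite T).toFinset, (deg G v : ℝ)) / (T.ncard : ℝ) ≥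
      (minDeg G : ℝ) + min ((T.ncard : ℝ) - 1) ((Real.log n) ^ 2)

/-- `G` is `p`-pseudorandom. -/
def IsPseudorandom (n : ℕ) (G : SimpleGraph (Fin n)) (p : ℝ) : Prop :=
  IsJumbled G p (2 * Real.sqrt (n * p * (1 - p))) ∧
  (∀ S T : Set (Fin n), Disjoint S T →
    ((1 / (S.ncard : ℝ) + 1 / (T.ncard : ℝ)) * Real.log n / p ≥ 7 / 2 →
      (eBtw G S T : ℝ) ≤ 2 * ((S.ncard : ℝ) + (T.ncard : ℝ)) * Real.log n) ∧
    ((1 / (S.ncard : ℝ) + 1 / (T.ncard : ℝ)) * Real.log n / p ≤ 7 / 2 →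
      (eBtw G S T : ℝ) ≤ 7 * (S.ncard : ℝ) * (T.ncard : ℝ) * p)) ∧
  (∀ S : Set (Fin n),
    (Real.log n / ((S.ncard : ℝ) * p) ≥ 7 / 4 → (eIn G S : ℝ) ≤ 2 * (S.ncard : ℝ) * Real.log n) ∧
    (Real.log n / ((S.ncard : ℝ) * p) ≤ 7 / 4 → (eIn G S : ℝ) ≤ 7 * (S.ncard : ℝ) ^ 2 * p / 2)) ∧
  ((n : ℝ) * p - 2 * Real.sqrt ((n : ℝ) * p * Real.log n) ≤ (minDeg G : ℝ) ∧
    (minDeg G : ℝ) ≤ (n : ℝ) * p - 200 * Real.sqrt ((n : ℝ) * p * (1 - p)) ∧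
    (maxDeg G : ℝ) ≤ (n : ℝ) * p + 2 * Real.sqrt ((n : ℝ) * p * Real.log n)) ∧
  StronglyTwoJumping n G

/-- `G` is `u`-jumping. -/
def IsJumping (n : ℕ) (G : SimpleGraph (Fin n)) (u : ℝ) : Prop :=
  ∃ x₀ : Fin n, deg G x₀ = minDeg G ∧
    ∀ x : Fin n, x ≠ x₀ → (deg G x : ℝ) ≥ (minDeg G : ℝ) + u

/-- `C` is a Hamilton cycle (on the whole vertex set `Fin n`). -/
def IsHamCycle {n : ℕ} (C : SimpleGraph (Fin n)) : Prop :=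
  ∃ (v : Fin n) (w : C.Walk v v), w.IsHamiltonianCycle ∧ C.edgeSet = {e | e ∈ w.edges}

/-- `G` has property `H`. -/
def HasPropertyH (n : ℕ) (G : SimpleGraph (Fin n)) : Prop :=
  ∃ HC : Fin (minDeg G / 2) → SimpleGraph (Fin n),
    (∀ i, HC i ≤ G ∧ IsHamCycle (HC i)) ∧
    (∀ i j, i ≠ j → Disjoint (HC i).edgeSet (HC j).edgeSet) ∧
    (Odd (minDeg G) →
      ∃ M : SimpleGraph (Fin n), M ≤ G ∧ (∀ v, deg M v ≤ 1) ∧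
        M.edgeSet.ncard = n / 2 ∧ ∀ i, Disjoint M.edgeSet (HC i).edgeSet)

/-- Probability of the event `A` under the binomial random graph `G_{n,p}`. -/
noncomputable def gnpProb (n : ℕ) (p : ℝ) (A : SimpleGraph (Fin n) → Prop) : ℝ :=
  ∑ G : SimpleGraph (Fin n),
    if A G then p ^ G.edgeSet.ncard * (1 - p) ^ (n.choose 2 - G.edgeSet.ncard) else 0


/-- Number of cycles of a 2-regular graph = number of connected components. -/
noncomputable def numCycles {V : Type} (F : SimpleGraph V) : ℕ := Nat.card F.ConnectedComponent

/-- `N` is a perfect matching on the whole vertex set. -/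
def IsPerfectMatchingGraph {n : ℕ} (N : SimpleGraph (Fin n)) : Prop :=
  ∀ v, ((N.neighborSet v).ncard) = 1

/-- `N` is a perfect pseudomatching: one vertex of degree 2, all others of degree 1. -/
def IsPerfectPseudomatching {n : ℕ} (N : SimpleGraph (Fin n)) : Prop :=
  ∃ w, ((N.neighborSet w).ncard) = 2 ∧ ∀ v, v ≠ w → ((N.neighborSet v).ncard) = 1

/-- A set of edges forms a matching (no two distinct edges share a vertex). -/
def IsMatchingSet {n : ℕ} (E : Set (Sym2 (Fin n))) : Prop :=
  ∀ e ∈ E, ∀ f ∈ E, e ≠ f → ∀ v : Fin n, v ∈ e → v ∉ f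

/-- Number of cycles (orbits, including fixed points) of a permutation. -/
noncomputable def cycleCount {α : Type} (σ : Equiv.Perm α) : ℕ :=
  Nat.card (Quotient (⟨σ.SameCycle,
    ⟨fun x => Equiv.Perm.SameCycle.refl σ x, fun h => h.symm, fun h h' => h.trans h'⟩⟩ : Setoid α))

/-- Edges of the bipartite graph given by the relation `R` between `S` and `T`. -/
noncomputable def eBip {n : ℕ} (R : Fin n → Fin n → Prop) (S T : Set (Fin n)) : ℕ :=
  {q : Fin n × Fin n | q.1 ∈ S ∧ q.2 ∈ T ∧ R q.1 q.2}.ncard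

/-- One rotation of a path (represented as a list of vertices), with new edge from `H`
and pivot in `Q`. -/
def RotStep {V : Type} (H : SimpleGraph V) (Q : Set V) (l l' : List V) : Prop :=
  ∃ (x : V) (a : List V) (p : V) (b : List V),
    l = (x :: a) ++ p :: b ∧ l' = (x :: a).reverse ++ p :: b ∧ p ∈ Q ∧ H.Adj x p

/-- `v` is `(H, Q, τ)`-reachable from the path `l`. -/
def ReachableVert {V : Type} (H : SimpleGraph V) (Q : Set V) (τ : ℕ) (l : List V) (v : V) : Prop :=
  ∃ (k : ℕ) (f : ℕ → List V), k ≤ τ ∧ f 0 = l ∧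
    (∀ i < k, RotStep H Q (f i) (f (i + 1))) ∧ (f k).head? = some v

/-- External neighbourhood. -/
def extNbhd {V : Type} (H : SimpleGraph V) (S : Set V) : Set V :=
  (⋃ x ∈ S, H.neighborSet x) \ S

end EDHC

namespace EDHC

lemma minDeg_le_deg {V : Type} (G : SimpleGraph V) (v : V) : minDeg G ≤ deg G v :=
  Nat.sInf_le ⟨v, rfl⟩

lemma deg_mono {V : Type} [Finite V] {G H : SimpleGraph V} (h : H ≤ G) (v : V) :
    deg H v ≤ deg G v :=
  Set.ncard_le_ncard (fun _ hu => h hu) (Set.toFinite _)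

lemma minDeg_mono {V : Type} [Finite V] [Nonempty V] {G H : SimpleGraph V} (h : H ≤ G) :
    minDeg H ≤ minDeg G := by
  obtain ⟨v, hv⟩ : minDeg G ∈ Set.range (deg G) := Nat.sInf_mem (Set.range_nonempty _)
  rw [← hv]
  exact (minDeg_le_deg H v).trans (deg_mono h v)

lemma deg_eq_card_filter {V : Type} [Fintype V] (G : SimpleGraph V) (v : V) :
    deg G v = (Finset.univ.filter (G.Adj v)).card := by
  rw [deg, ← Set.ncard_coe_finset]
  congr 1
  ext u
  simp

/-- Edges inside `S`, inside `T` and between `S` and `T` all lie inside `S ∪ T`. -/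
lemma card_adj_add_eIn_le {V : Type} [Fintype V] (G : SimpleGraph V) (S T : Finset V)
    (hST : Disjoint S T) :
    ((S ×ˢ T).filter (fun z => G.Adj z.1 z.2)).card + eIn G S + eIn G T
      ≤ eIn G (S ∪ T : Finset V) := by
  set B : Set (Sym2 V) :=
    Set.image (fun z : V × V => s(z.1, z.2)) ((S ×ˢ T).filter (fun z => G.Adj z.1 z.2) : Finset (V × V))
    with hB
  have hdis : ∀ v, v ∈ S → v ∈ T → False := fun v h1 h2 => Finset.disjoint_left.mp hST h1 h2
  have hBcard : B.ncard = ((S ×ˢ T).filter (fun z => G.Adj z.1 z.2)).card := by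
    rw [hB, Set.InjOn.ncard_image, Set.ncard_coe_finset]
    rintro ⟨a, b⟩ h1 ⟨c, d⟩ h2 h
    simp only [Finset.coe_filter, Finset.mem_product, Set.mem_ofPred_eq] at h1 h2
    rcases Sym2.eq_iff.mp h with ⟨rfl, rfl⟩ | ⟨rfl, rfl⟩
    · rfl
    · exact (hdis _ h1.1.1 h2.1.2).elim
  have hd1 : Disjoint B {e ∈ G.edgeSet | ∀ v ∈ e, v ∈ (S : Set V)} := by
    rw [Set.disjoint_left]
    rintro _ ⟨⟨a, b⟩, h1, rfl⟩ h2
    simp only [Finset.coe_filter, Finset.mem_product, Set.mem_ofPred_eq] at h1 h2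
    exact hdis b (by simpa using h2.2 b (by simp)) h1.1.2
  have hd2 : Disjoint (B ∪ {e ∈ G.edgeSet | ∀ v ∈ e, v ∈ (S : Set V)})
      {e ∈ G.edgeSet | ∀ v ∈ e, v ∈ (T : Set V)} := by
    rw [Set.disjoint_left]
    rintro e (⟨⟨a, b⟩, h1, rfl⟩ | h1) h2
    · simp only [Finset.coe_filter, Finset.mem_product, Set.mem_ofPred_eq] at h1 h2
      exact hdis a h1.1.1 (by simpa using h2.2 a (by simp))
    · induction e with
      | _ a b => exact hdis a (by simpa using h1.2 a (by simp)) (by simpa using h2.2 a (by simp))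
  rw [← hBcard, eIn, eIn, eIn, ← Set.ncard_union_eq hd1, ← Set.ncard_union_eq hd2]
  apply Set.ncard_le_ncard
  · rintro e ((⟨⟨a, b⟩, h1, rfl⟩ | h1) | h1)
    · simp only [Finset.coe_filter, Finset.mem_product, Set.mem_ofPred_eq] at h1
      simp [h1.1.1, h1.1.2, h1.2]
    · exact ⟨h1.1, fun v hv => by simpa using Or.inl (by simpa using h1.2 v hv)⟩
    · exact ⟨h1.1, fun v hv => by simpa using Or.inr (by simpa using h1.2 v hv)⟩
  · exact Set.toFinite _

/-- The upper half of the expander mixing lemma for jumbled graphs. -/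
lemma IsJumbled.card_adj_le {V : Type} [Fintype V] {G : SimpleGraph V} {p β : ℝ}
    (hG : IsJumbled G p β) (S T : Finset V) (hST : Disjoint S T) :
    (((S ×ˢ T).filter (fun z => G.Adj z.1 z.2)).card : ℝ)
      ≤ p * (S.card * T.card) + 2 * β * (S.card + T.card) := by
  have h := card_adj_add_eIn_le G S T hST
  have h' : (((S ×ˢ T).filter (fun z => G.Adj z.1 z.2)).card : ℝ) + eIn G S + eIn G T
      ≤ eIn G (S ∪ T : Finset V) := by exact_mod_cast h
  have h1 := (abs_le.mp (hG S)).1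
  have h2 := (abs_le.mp (hG T)).1
  have h3 := (abs_le.mp (hG (S ∪ T : Finset V))).2
  rw [Set.ncard_coe_finset] at h1 h2 h3
  rw [Finset.card_union_of_disjoint hST] at h3
  push_cast at h3 h'
  nlinarith

/-- Vertices of `S` with at least `D` neighbours each in a smaller set `T` bound `D` in terms
of `|S|`. -/
lemma IsJumbled.le_of_forall_le_card_adj {V : Type} [Fintype V] {G : SimpleGraph V} {p β D : ℝ}
    (hG : IsJumbled G p β) (hp : 0 ≤ p) (hβ : 0 ≤ β) (S T : Finset V) (hST : Disjoint S T)
    (hlt : T.card < S.card) (hdeg : ∀ v ∈ S, D ≤ ((T.filter (G.Adj v)).card : ℝ)) :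
    D ≤ p * S.card + 4 * β := by
  have h := hG.card_adj_le S T hST
  have hcard : ((S ×ˢ T).filter (fun z => G.Adj z.1 z.2)).card
      = ∑ v ∈ S, (T.filter (G.Adj v)).card := by
    simp only [Finset.card_filter, Finset.sum_product]
  rw [hcard] at h
  push_cast at h
  have h2 : (S.card : ℝ) * D ≤ ∑ v ∈ S, ((T.filter (G.Adj v)).card : ℝ) := by
    rw [← nsmul_eq_mul]
    exact Finset.card_nsmul_le_sum _ _ _ hdeg
  have hlt' : (T.card : ℝ) ≤ S.card := by exact_mod_cast hlt.le
  have hs : (0 : ℝ) < S.card := by exact_mod_cast (Nat.zero_le _).trans_lt hlt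
  have h3 : (S.card : ℝ) * D ≤ S.card * (p * S.card + 4 * β) := by
    have h4 : p * (S.card * T.card : ℝ) ≤ p * (S.card * S.card) := by gcongr
    have h5 : 2 * β * (S.card + T.card : ℝ) ≤ 2 * β * (S.card + S.card) := by gcongr
    linarith
  exact le_of_mul_le_mul_left h3 hs

/-- Perfect matchings in balanced bipartite subgraphs of a jumbled graph. -/
lemma IsJumbled.exists_perm_adj {V X : Type} [Fintype V] [Fintype X] {G H : SimpleGraph V}
    {p β D : ℝ} (hG : IsJumbled G p β) (hHG : H ≤ G) (hp : 0 ≤ p) (hβ : 0 ≤ β)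
    (a b : X → V) (ha : Function.Injective a) (hb : Function.Injective b)
    (hab : ∀ x y, a x ≠ b y)
    (hda : ∀ x, D ≤ ((Finset.univ.filter (fun y => H.Adj (a x) (b y))).card : ℝ))
    (hdb : ∀ y, D ≤ ((Finset.univ.filter (fun x => H.Adj (b y) (a x))).card : ℝ))
    (hD : p * ((Fintype.card X + 1) / 2) + 4 * β < D) :
    ∃ φ : Equiv.Perm X, ∀ x, H.Adj (a x) (b (φ x)) := by
  have key : ∀ (a b : X → V), Function.Injective a → Function.Injective b →
      (∀ x y, a x ≠ b y) →
      (∀ x, D ≤ ((Finset.univ.filter (fun y => H.Adj (a x) (b y))).card : ℝ)) →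
      ∀ S T : Finset X, (∀ x ∈ S, ∀ y, H.Adj (a x) (b y) → y ∈ T) → T.card < S.card →
        Fintype.card X + 1 < 2 * S.card := by
    intro a b ha hb hab hda S T hN hlt
    by_contra! hle
    have := hG.le_of_forall_le_card_adj (D := D) hp hβ (S.map ⟨a, ha⟩) (T.map ⟨b, hb⟩) ?_
      (by simpa using hlt) ?_
    · rw [Finset.card_map] at this
      have hle' : (2 : ℝ) * S.card ≤ Fintype.card X + 1 := by exact_mod_cast hle
      have : p * (S.card : ℝ) ≤ p * ((Fintype.card X + 1) / 2) := by
        apply mul_le_mul_of_nonneg_left _ hp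
        linarith
      linarith
    · rw [Finset.disjoint_left]
      simp only [Finset.mem_map, Function.Embedding.coeFn_mk]
      rintro _ ⟨x, -, rfl⟩ ⟨y, -, h⟩
      exact hab x y h.symm
    · simp only [Finset.mem_map, Function.Embedding.coeFn_mk]
      rintro _ ⟨x, hx, rfl⟩
      refine (hda x).trans ?_
      rw [Nat.cast_le, ← Finset.card_map ⟨b, hb⟩]
      apply Finset.card_le_card
      intro v
      simp only [Finset.mem_map, Finset.mem_filter, Finset.mem_univ, true_and,
        Function.Embedding.coeFn_mk]
      rintro ⟨y, hy, rfl⟩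
      exact ⟨⟨y, hN x hx y hy, rfl⟩, hHG hy⟩
  obtain ⟨f, hf, hfa⟩ := (Finset.all_card_le_biUnion_card_iff_exists_injective
    (fun x : X => Finset.univ.filter (fun y => H.Adj (a x) (b y)))).mp (by
      intro S
      by_contra! hlt
      set T := S.biUnion (fun x : X => Finset.univ.filter (fun y => H.Adj (a x) (b y))) with hT
      have h1 := key a b ha hb hab hda S T (fun x hx y hy => by
        rw [hT, Finset.mem_biUnion]
        exact ⟨x, hx, by simpa using hy⟩) hlt
      have hS := S.card_le_univ
      have hTc : Tᶜ.card = Fintype.card X - T.card := Finset.card_compl T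
      have hSc : Sᶜ.card = Fintype.card X - S.card := Finset.card_compl S
      obtain ⟨U, hU, hUc⟩ := Finset.exists_subset_card_eq
        (show Fintype.card X - S.card + 1 ≤ Tᶜ.card by omega)
      have h2 := key b a hb ha (fun x y h => hab y x h.symm) hdb U Sᶜ (fun y hy x hxy => by
        rw [Finset.mem_compl]
        intro hx
        refine Finset.mem_compl.mp (hU hy) ?_
        rw [hT, Finset.mem_biUnion]
        exact ⟨x, hx, by simpa using hxy.symm⟩) (by omega)
      omega)
  refine ⟨Equiv.ofBijective f (Finite.injective_iff_bijective.mp hf), fun x => ?_⟩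
  simpa using hfa x

/-- A union of Chernoff lower tail bounds: if the expected number of coordinates of a uniformly
random `ω` hitting `A k` is always at least `μ`, some `ω` hits every `A k` at least `a` times. -/
lemma exists_forall_le_card_hits {κ β Ω : Type} [Fintype κ] [Fintype β] [Fintype Ω] [Nonempty Ω]
    (A : κ → β → Finset Ω) (μ a : ℝ)
    (hμ : ∀ k, (Fintype.card Ω : ℝ) * μ ≤ ∑ b, ((A k b).card : ℝ))
    (hlt : (Fintype.card κ : ℝ) * Real.exp (a * Real.log 2 - μ / 2) < 1) :
    ∃ ω : β → Ω, ∀ k, a ≤ ((Finset.univ.filter (fun b => ω b ∈ A k b)).card : ℝ) := by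
  by_contra! hbad
  set M : ℝ := (Fintype.card Ω : ℝ) with hM
  have hM0 : 0 < M := by rw [hM]; exact_mod_cast Fintype.card_pos
  set wt : κ → (β → Ω) → ℝ := fun k ω => ∏ b, (if ω b ∈ A k b then (1 / 2 : ℝ) else 1) with hwt
  have hwt0 : ∀ k ω, 0 ≤ wt k ω := fun k ω =>
    Finset.prod_nonneg fun b _ => by split_ifs <;> norm_num
  have hupper : ∀ k, ∑ ω, wt k ω ≤ M ^ Fintype.card β * Real.exp (-μ / 2) := by
    intro k
    have h1 : ∑ ω, wt k ω = ∏ b, ∑ o : Ω, (if o ∈ A k b then (1 / 2 : ℝ) else 1) := by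
      rw [Finset.prod_univ_sum, Fintype.piFinset_univ]
    have h2 : ∀ b, ∑ o : Ω, (if o ∈ A k b then (1 / 2 : ℝ) else 1)
        = M - (A k b).card / 2 := by
      intro b
      have : ∀ o : Ω, (if o ∈ A k b then (1 / 2 : ℝ) else 1)
          = 1 - (if o ∈ A k b then (1 / 2 : ℝ) else 0) := by
        intro o; split_ifs <;> norm_num
      simp only [this, Finset.sum_sub_distrib, Finset.sum_const, Finset.card_univ, nsmul_eq_mul,
        mul_one, Finset.sum_ite_mem, Finset.univ_inter, hM]
      ring
    have h3 : ∀ b, M - ((A k b).card : ℝ) / 2 ≤ M * Real.exp (-((A k b).card / (2 * M))) := by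
      intro b
      have := Real.add_one_le_exp (-(((A k b).card : ℝ) / (2 * M)))
      calc M - ((A k b).card : ℝ) / 2 = M * (-(((A k b).card : ℝ) / (2 * M)) + 1) := by
            field_simp; ring
        _ ≤ _ := by gcongr
    have h4 : ∀ b, (0 : ℝ) ≤ M - ((A k b).card : ℝ) / 2 := by
      intro b
      rw [← h2]
      exact Finset.sum_nonneg fun o _ => by split_ifs <;> norm_num
    rw [h1]
    simp only [h2]
    refine (Finset.prod_le_prod (fun b _ => h4 b) (fun b _ => h3 b)).trans ?_
    rw [Finset.prod_mul_distrib, Finset.prod_const, Finset.card_univ, ← Real.exp_sum]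
    gcongr
    rw [Finset.sum_neg_distrib, ← Finset.sum_div]
    have := hμ k
    rw [neg_div, neg_le_neg_iff, div_le_div_iff₀ (by norm_num) (by positivity)]
    linarith
  have hlower : ∀ ω, Real.exp (-(a * Real.log 2)) ≤ ∑ k, wt k ω := by
    intro ω
    obtain ⟨k, hk⟩ := hbad ω
    refine le_trans ?_ (Finset.single_le_sum (fun k _ => hwt0 k ω) (Finset.mem_univ k))
    have : wt k ω = Real.exp
        (-((Finset.univ.filter (fun b => ω b ∈ A k b)).card * Real.log 2)) := by
      simp only [hwt]
      rw [Finset.prod_ite, Finset.prod_const, Finset.prod_const_one, mul_one, Real.exp_neg,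
        Real.exp_nat_mul, Real.exp_log (by norm_num)]
      simp
    rw [this]
    have := Real.log_pos (show (1 : ℝ) < 2 by norm_num)
    gcongr
  have htotal : M ^ Fintype.card β * Real.exp (-(a * Real.log 2))
      ≤ Fintype.card κ * (M ^ Fintype.card β * Real.exp (-μ / 2)) := by
    calc M ^ Fintype.card β * Real.exp (-(a * Real.log 2))
        = ∑ _ω : β → Ω, Real.exp (-(a * Real.log 2)) := by simp [hM]
      _ ≤ ∑ ω, ∑ k, wt k ω := Finset.sum_le_sum fun ω _ => hlower ω
      _ = ∑ k, ∑ ω, wt k ω := Finset.sum_comm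
      _ ≤ ∑ _k : κ, M ^ Fintype.card β * Real.exp (-μ / 2) :=
          Finset.sum_le_sum fun k _ => hupper k
      _ = _ := by simp
  have hMp : 0 < M ^ Fintype.card β := by positivity
  have h5 : Real.exp (-(a * Real.log 2)) ≤ Fintype.card κ * Real.exp (-μ / 2) := by
    apply le_of_mul_le_mul_left _ hMp
    linarith
  have h6 : (1 : ℝ) ≤ Fintype.card κ * Real.exp (a * Real.log 2 - μ / 2) := by
    calc (1 : ℝ) = Real.exp (a * Real.log 2) * Real.exp (-(a * Real.log 2)) := by
          rw [← Real.exp_add]; simp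
      _ ≤ Real.exp (a * Real.log 2) * (Fintype.card κ * Real.exp (-μ / 2)) := by gcongr
      _ = _ := by
          rw [mul_left_comm, ← Real.exp_add]
          ring_nf
  linarith

/-- A labelling of pairs of vertices by `q` blocks of `k + 1` pairs, and `w` leftover pairs, can be
rearranged within the blocks so that all degrees into every class of labels are large. -/
lemma exists_balanced_labelling {V : Type} [Fintype V] (H : SimpleGraph V) {q k w : ℕ} (τ : V → V)
    (e : (Fin q × Fin (k + 1) ⊕ Fin w) × Bool → V) (he : Function.Injective e)
    (hτ : ∀ j x, e (j, !x) = τ (e (j, x))) (δ a : ℝ)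
    (hδ : ∀ v, δ ≤ ((Finset.univ.filter
      (fun z : (Fin q × Fin (k + 1)) × Bool => H.Adj v (e (Sum.inl z.1, z.2)))).card : ℝ))
    (hlt : ((Fintype.card V * ((k + 1) * 2) : ℕ) : ℝ)
      * Real.exp (a * Real.log 2 - δ / (2 * (k + 1)) / 2) < 1) :
    ∃ e' : (Fin q × Fin (k + 1) ⊕ Fin w) × Bool → V, Function.Injective e' ∧
      Set.range e' = Set.range e ∧ (∀ j x, e' (j, !x) = τ (e' (j, x))) ∧
      ∀ v i x, a ≤ ((Finset.univ.filter
        (fun b : Fin q => H.Adj v (e' (Sum.inl (b, i), x)))).card : ℝ) := by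
  obtain ⟨ω, hω⟩ := exists_forall_le_card_hits (κ := V × Fin (k + 1) × Bool) (β := Fin q)
    (Ω := Fin (k + 1) × Bool)
    (fun c b => Finset.univ.filter
      (fun o => H.Adj c.1 (e (Sum.inl (b, c.2.1 - o.1), xor c.2.2 o.2))))
    (δ / (2 * (k + 1))) a (by
      rintro ⟨v, i, x⟩
      have h1 : ((Fintype.card (Fin (k + 1) × Bool) : ℕ) : ℝ) * (δ / (2 * (k + 1))) = δ := by
        simp
        field_simp
      rw [h1]
      refine (hδ v).trans (le_of_eq ?_)
      rw [← Nat.cast_sum, ← Finset.card_sigma]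
      congr 1
      refine Finset.card_nbij' (fun z => ⟨z.1.1, i - z.1.2, xor x z.2⟩)
        (fun z => ((z.1, i - z.2.1), xor x z.2.2)) ?_ ?_ ?_ ?_
      · rintro ⟨⟨b, i'⟩, y⟩ h
        simpa using h
      · rintro ⟨b, i', y⟩ h
        simpa using h
      · rintro ⟨⟨b, i'⟩, y⟩ -
        simp
      · rintro ⟨b, i', y⟩ -
        simp) (by
      refine lt_of_eq_of_lt ?_ hlt
      simp)
  set π : (Fin q × Fin (k + 1) ⊕ Fin w) × Bool → (Fin q × Fin (k + 1) ⊕ Fin w) × Bool := fun z =>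
    match z with
    | (Sum.inl (b, i), x) => (Sum.inl (b, i - (ω b).1), xor x (ω b).2)
    | (Sum.inr t, x) => (Sum.inr t, x) with hπ
  have hinj : Function.Injective π := by
    rintro ⟨⟨b, i⟩ | t, x⟩ ⟨⟨b', i'⟩ | t', x'⟩ h
    · simp only [hπ, Prod.mk.injEq, Sum.inl.injEq] at h
      obtain ⟨⟨rfl, h1⟩, h2⟩ := h
      simp_all
    · simp [hπ] at h
    · simp [hπ] at h
    · simpa [hπ] using h
  refine ⟨e ∘ π, he.comp hinj, (Finite.injective_iff_surjective.mp hinj).range_comp e, ?_, ?_⟩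
  · rintro (⟨b, i⟩ | t) x
    · simp only [Function.comp, hπ, ← hτ, Bool.not_xor]
    · simp only [Function.comp, hπ, ← hτ]
  · intro v i x
    simpa [hπ] using hω (v, i, x)

/-- Matchings from each class to the next one assemble into a permutation every cycle of which
meets the first class or the set of leftover labels. -/
lemma IsJumbled.exists_perm_labels {V : Type} [Fintype V] {G H : SimpleGraph V} {p β D : ℝ}
    (hG : IsJumbled G p β) (hHG : H ≤ G) (hp : 0 ≤ p) (hβ : 0 ≤ β) {q k w : ℕ}
    (e : (Fin q × Fin (k + 1) ⊕ Fin w) × Bool → V) (he : Function.Injective e)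
    (hdeg : ∀ v i x, D ≤ ((Finset.univ.filter
        (fun b : Fin q => H.Adj v (e (Sum.inl (b, i), x)))).card : ℝ))
    (hD : p * (((q + w : ℕ) + 1) / 2) + 4 * β < D) :
    ∃ σ : Equiv.Perm (Fin q × Fin (k + 1) ⊕ Fin w),
      (∀ j, H.Adj (e (j, true)) (e (σ j, false))) ∧
      ∀ {γ : Type} (C : Fin q × Fin (k + 1) ⊕ Fin w → γ), (∀ j, C (σ j) = C j) →
        ∀ j, ∃ z : Fin q ⊕ Fin w, C (Sum.map (fun b => (b, 0)) id z) = C j := by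
  set f : Fin q × Fin (k + 1) ⊕ Fin w → Fin (k + 1) :=
    Sum.elim Prod.snd (fun _ => Fin.last k) with hf
  set π : Equiv.Perm (Fin q × Fin (k + 1) ⊕ Fin w) :=
    Equiv.sumCongr (Equiv.prodCongr (Equiv.refl _) (Equiv.addRight 1)) (Equiv.refl _) with hπ
  have hmatch : ∀ c : Fin (k + 1), ∃ φ : Equiv.Perm {j // f j = c},
      ∀ j, H.Adj (e (j.1, true)) (e (π (φ j).1, false)) := by
    intro c
    set g : Fin q → {j // f j = c} := fun b => ⟨Sum.inl (b, c), rfl⟩ with hg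
    have hginj : Function.Injective g := by
      intro b b' h
      simpa [hg] using congrArg Subtype.val h
    refine hG.exists_perm_adj hHG hp hβ (D := D) (fun j : {j // f j = c} => e (j.1, true))
      (fun j => e (π j.1, false)) ?_ ?_ ?_ ?_ ?_ ?_
    · intro j j' h
      simpa [Subtype.ext_iff] using he h
    · intro j j' h
      simpa [Subtype.ext_iff] using he h
    · intro j j' h
      simpa using he h
    · intro j
      refine (hdeg (e (j.1, true)) (c + 1) false).trans ?_
      rw [Nat.cast_le, ← Finset.card_map ⟨g, hginj⟩]
      apply Finset.card_le_card
      intro y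
      simp only [Finset.mem_map, Finset.mem_filter, Finset.mem_univ, true_and,
        Function.Embedding.coeFn_mk]
      rintro ⟨b, hb, rfl⟩
      simpa [hg, hπ] using hb
    · intro j
      refine (hdeg (e (π j.1, false)) c true).trans ?_
      rw [Nat.cast_le, ← Finset.card_map ⟨g, hginj⟩]
      apply Finset.card_le_card
      intro y
      simp only [Finset.mem_map, Finset.mem_filter, Finset.mem_univ, true_and,
        Function.Embedding.coeFn_mk]
      rintro ⟨b, hb, rfl⟩
      simpa [hg] using hb
    · refine lt_of_le_of_lt ?_ hD
      have hcard : Fintype.card {j // f j = c} ≤ q + w := by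
        have := Fintype.card_le_of_injective
          (fun j : {j // f j = c} => (Sum.map Prod.fst id j.1 : Fin q ⊕ Fin w)) (by
            rintro ⟨⟨b, i⟩ | t, h⟩ ⟨⟨b', i'⟩ | t', h'⟩ hh
            · simp only [hf, Sum.elim_inl] at h h'
              subst h
              subst h'
              simpa using hh
            · simp at hh
            · simp at hh
            · simpa using hh)
        simpa using this
      have hcard' : ((Fintype.card {j // f j = c} : ℕ) : ℝ) ≤ (q + w : ℕ) := by
        exact_mod_cast hcard
      gcongr
  choose φ hφ using hmatch
  set ρ : Equiv.Perm (Fin q × Fin (k + 1) ⊕ Fin w) :=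
    ((Equiv.sigmaFiberEquiv f).symm.trans (Equiv.sigmaCongrRight φ)).trans
      (Equiv.sigmaFiberEquiv f) with hρ
  have hρφ : ∀ j, ρ j = (φ (f j) ⟨j, rfl⟩).1 := fun j => rfl
  have hfρ : ∀ j, f (ρ j) = f j := fun j => (φ (f j) ⟨j, rfl⟩).2
  refine ⟨ρ.trans π, fun j => hφ (f j) ⟨j, rfl⟩, ?_⟩
  intro γ C hC j
  rcases j with ⟨b, i⟩ | t
  · induction i using Fin.induction generalizing b with
    | zero => exact ⟨Sum.inl b, rfl⟩
    | succ i ih =>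
      obtain ⟨j, hj⟩ := ρ.surjective (Sum.inl (b, i.castSucc))
      have hfj : f j = i.castSucc := by rw [← hfρ, hj]; rfl
      have hCj : C (Sum.inl (b, i.succ)) = C j := by
        rw [← hC j, Equiv.trans_apply, hj]
        simp [hπ, Fin.coeSucc_eq_succ]
      rcases j with ⟨b', i'⟩ | t
      · obtain rfl : i' = i.castSucc := hfj
        rw [hCj]
        exact ih b'
      · exact absurd hfj.symm (Fin.castSucc_lt_last i).ne
  · exact ⟨Sum.inr t, rfl⟩

/-- The structure common to perfect matchings and perfect pseudomatchings: the vertices other than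
at most one exceptional vertex of degree two are paired up within the components of `P`. -/
structure IsPairing {V : Type} (P : SimpleGraph V) (τ : V → V) : Prop where
  invol : Function.Involutive τ
  reachable : ∀ v, P.Reachable v (τ v)
  deg_of_ne : ∀ v, τ v ≠ v → deg P v = 1
  deg_of_eq : ∀ v, τ v = v → deg P v = 2
  eq_of_fixed : ∀ u v, τ u = u → τ v = v → u = v

lemma exists_isPairing_of_matching {n : ℕ} {P : SimpleGraph (Fin n)}
    (hP : IsPerfectMatchingGraph P) : ∃ τ, IsPairing P τ := by
  choose τ hτ using fun v => Set.ncard_eq_one.mp (hP v)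
  have hadj : ∀ v u, P.Adj v u ↔ u = τ v := fun v u => by
    rw [← SimpleGraph.mem_neighborSet, hτ v, Set.mem_singleton_iff]
  have hv : ∀ v, P.Adj v (τ v) := fun v => (hadj v _).mpr rfl
  exact ⟨τ, fun v => ((hadj _ _).mp (hv v).symm).symm, fun v => (hv v).reachable,
    fun v _ => hP v, fun v h => absurd h (hv v).ne', fun u _ h => absurd h (hv u).ne'⟩

lemma exists_isPairing_of_pseudomatching {n : ℕ} {P : SimpleGraph (Fin n)}
    (hP : IsPerfectPseudomatching P) : ∃ τ, IsPairing P τ := by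
  obtain ⟨w, hw, hP⟩ := hP
  obtain ⟨x, y, hxy, hwn⟩ := Set.ncard_eq_two.mp hw
  have hex : ∀ v, ∃ u, v ≠ w → P.neighborSet v = {u} := fun v => by
    by_cases h : v = w
    · exact ⟨v, fun h' => absurd h h'⟩
    · obtain ⟨u, hu⟩ := Set.ncard_eq_one.mp (hP v h)
      exact ⟨u, fun _ => hu⟩
  choose η hη using hex
  have hadj : ∀ v u, v ≠ w → (P.Adj v u ↔ u = η v) := fun v u h => by
    rw [← SimpleGraph.mem_neighborSet, hη v h, Set.mem_singleton_iff]
  have hadjw : ∀ u, P.Adj w u ↔ u = x ∨ u = y := fun u => by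
    rw [← SimpleGraph.mem_neighborSet, hwn]; simp
  have hwx : P.Adj w x := (hadjw x).mpr (Or.inl rfl)
  have hwy : P.Adj w y := (hadjw y).mpr (Or.inr rfl)
  have hηw : ∀ v, v ≠ w → v ≠ x → v ≠ y → η v ≠ w := by
    intro v h1 h2 h3 h
    have := ((hadj v w h1).mpr h.symm).symm
    rw [hadjw] at this
    tauto
  have hηη : ∀ v, v ≠ w → η v ≠ w → η (η v) = v := fun v h h' =>
    ((hadj _ _ h').mp ((hadj v _ h).mpr rfl).symm).symm
  have hηx : η x = w := ((hadj x w hwx.ne').mp hwx.symm).symm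
  have hηy : η y = w := ((hadj y w hwy.ne').mp hwy.symm).symm
  set τ : Fin n → Fin n := fun v => if v = w then w else if v = x then y else if v = y then x
    else η v with hτ
  have hτw : τ w = w := by simp [hτ]
  have hτx : τ x = y := by simp [hτ, hwx.ne']
  have hτy : τ y = x := by simp [hτ, hwy.ne', hxy.symm]
  have hτv : ∀ v, v ≠ w → v ≠ x → v ≠ y → τ v = η v := fun v h1 h2 h3 => by simp [hτ, h1, h2, h3]
  have hfix : ∀ v, τ v = v → v = w := by
    intro v h
    by_contra h1
    by_cases h2 : v = x
    · rw [h2, hτx] at h; exact hxy h.symm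
    by_cases h3 : v = y
    · rw [h3, hτy] at h; exact hxy h
    rw [hτv v h1 h2 h3] at h
    exact ((hadj v _ h1).mpr rfl).ne' h
  refine ⟨τ, ?_, ?_, ?_, ?_, ?_⟩
  · intro v
    by_cases h1 : v = w
    · rw [h1, hτw, hτw]
    by_cases h2 : v = x
    · rw [h2, hτx, hτy]
    by_cases h3 : v = y
    · rw [h3, hτy, hτx]
    have h4 := hηw v h1 h2 h3
    have h5 := hηη v h1 h4
    rw [hτv v h1 h2 h3, hτv _ h4, h5]
    · intro h; rw [h, hηx] at h5; exact h1 h5.symm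
    · intro h; rw [h, hηy] at h5; exact h1 h5.symm
  · intro v
    by_cases h1 : v = w
    · rw [h1, hτw]
    by_cases h2 : v = x
    · rw [h2, hτx]
      exact hwx.symm.reachable.trans hwy.reachable
    by_cases h3 : v = y
    · rw [h3, hτy]
      exact hwy.symm.reachable.trans hwx.reachable
    rw [hτv v h1 h2 h3]
    exact ((hadj v _ h1).mpr rfl).reachable
  · intro v h
    exact hP v fun h' => h (by rw [h', hτw])
  · intro v h
    rw [hfix v h]
    exact hw
  · intro u v hu hv
    rw [hfix u hu, hfix v hv]

/-- An involution on an ordered finite type pairs up its non-fixed points. -/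
lemma exists_labelling {V : Type} [Fintype V] [LinearOrder V] {τ : V → V}
    (hτ : Function.Involutive τ) (hfix : ∀ u v, τ u = u → τ v = v → u = v) :
    ∃ m : ℕ, m = Fintype.card V / 2 ∧ ∃ e : Fin m × Bool → V, Function.Injective e ∧
      Set.range e = {v | τ v ≠ v} ∧ ∀ j x, e (j, !x) = τ (e (j, x)) := by
  set e : {v // v < τ v} × Bool → V := fun z => if z.2 then τ z.1.1 else z.1.1 with he
  have hinj : Function.Injective e := by
    rintro ⟨⟨u, hu⟩, x⟩ ⟨⟨v, hv⟩, y⟩ h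
    cases x <;> cases y <;> simp only [he, if_true, Bool.false_eq_true, if_false] at h
    · subst h; rfl
    · subst h; rw [hτ v] at hu; exact absurd hu hv.asymm
    · subst h; rw [hτ u] at hv; exact absurd hu hv.asymm
    · have := hτ.injective h
      subst this; rfl
  have hrange : Set.range e = {v | τ v ≠ v} := by
    ext v
    constructor
    · rintro ⟨⟨⟨u, hu⟩, x⟩, rfl⟩
      cases x
      · exact hu.ne'
      · simpa [he, hτ u] using hu.ne
    · intro h
      rcases lt_or_gt_of_ne (show τ v ≠ v from h) with h | h
      · exact ⟨(⟨τ v, by rwa [hτ v]⟩, true), by simp [he, hτ v]⟩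
      · exact ⟨(⟨v, h⟩, false), by simp [he]⟩
  have hflip : ∀ j x, e (j, !x) = τ (e (j, x)) := by
    rintro ⟨v, hv⟩ x
    cases x <;> simp [he, hτ v]
  have hcard : Fintype.card {v // v < τ v} = Fintype.card V / 2 := by
    have h1 : (Finset.univ.filter (fun v => τ v ≠ v)).card = Fintype.card {v // v < τ v} * 2 := by
      have h2 : Finset.univ.filter (fun v => τ v ≠ v) = Finset.univ.map ⟨e, hinj⟩ := by
        ext v
        have := Set.ext_iff.mp hrange v
        simpa using this.symm
      rw [h2, Finset.card_map]
      simp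
    have h3 : (Finset.univ.filter (fun v => ¬ τ v ≠ v)).card ≤ 1 := by
      rw [Finset.card_le_one]
      intro u hu v hv
      exact hfix u v (by simpa using hu) (by simpa using hv)
    have h4 := Finset.card_filter_add_card_filter_not (s := (Finset.univ : Finset V))
      (fun v => τ v ≠ v)
    rw [Finset.card_univ] at h4
    omega
  set E := Fintype.equivFin {v // v < τ v}
  refine ⟨_, hcard, fun z => e (E.symm z.1, z.2), ?_, ?_, fun j x => hflip _ x⟩
  · rintro ⟨i, x⟩ ⟨j, y⟩ h
    simpa using hinj h
  · rw [← hrange]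
    ext v
    constructor
    · rintro ⟨z, rfl⟩
      exact ⟨_, rfl⟩
    · rintro ⟨⟨j, x⟩, rfl⟩
      exact ⟨(E j, x), by simp⟩

/-- The 2-factor obtained from a pairing and a permutation of the pairs along edges of `H`. -/
lemma IsPairing.exists_matching {V : Type} [Finite V] {P H : SimpleGraph V} {τ : V → V}
    (hP : IsPairing P τ) (hPH : Disjoint P.edgeSet H.edgeSet) {ι ζ : Type} [Finite ζ]
    (e : ι × Bool → V) (he : Function.Injective e) (hrange : Set.range e = {v | τ v ≠ v})
    (hτ : ∀ j x, e (j, !x) = τ (e (j, x))) (σ : Equiv.Perm ι)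
    (hσ : ∀ j, H.Adj (e (j, true)) (e (σ j, false))) (r : ζ → ι)
    (hr : ∀ {γ : Type} (C : ι → γ), (∀ j, C (σ j) = C j) → ∀ j, ∃ z, C (r z) = C j) :
    ∃ P' : SimpleGraph V, P' ≤ H ∧ (∀ v, deg P' v ≤ 1) ∧ (∀ v, deg (P ⊔ P') v = 2) ∧
      numCycles (P ⊔ P') ≤ Nat.card ζ := by
  set P' : SimpleGraph V :=
    SimpleGraph.fromRel (fun u v => ∃ j, u = e (j, true) ∧ v = e (σ j, false)) with hP'
  have hadj : ∀ u v, P'.Adj u v ↔ (∃ j, u = e (j, true) ∧ v = e (σ j, false)) ∨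
      ∃ j, v = e (j, true) ∧ u = e (σ j, false) := by
    intro u v
    rw [hP', SimpleGraph.fromRel_adj, and_iff_right_iff_imp]
    rintro (⟨j, rfl, rfl⟩ | ⟨j, rfl, rfl⟩)
    · exact (hσ j).ne
    · exact (hσ j).ne'
  have hle : P' ≤ H := by
    intro u v h
    rcases (hadj u v).mp h with ⟨j, rfl, rfl⟩ | ⟨j, rfl, rfl⟩
    · exact hσ j
    · exact (hσ j).symm
  have hN1 : ∀ j, P'.neighborSet (e (j, true)) = {e (σ j, false)} := by
    intro j
    ext v
    rw [SimpleGraph.mem_neighborSet, hadj, Set.mem_singleton_iff]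
    constructor
    · rintro (⟨i, h, rfl⟩ | ⟨i, rfl, h⟩)
      · have h1 : j = i := (Prod.ext_iff.mp (he h)).1
        rw [h1]
      · simpa using (Prod.ext_iff.mp (he h)).2
    · rintro rfl
      exact Or.inl ⟨j, rfl, rfl⟩
  have hN2 : ∀ j, P'.neighborSet (e (j, false)) = {e (σ.symm j, true)} := by
    intro j
    ext v
    rw [SimpleGraph.mem_neighborSet, hadj, Set.mem_singleton_iff]
    constructor
    · rintro (⟨i, h, rfl⟩ | ⟨i, rfl, h⟩)
      · simpa using (Prod.ext_iff.mp (he h)).2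
      · have h1 : j = σ i := (Prod.ext_iff.mp (he h)).1
        rw [h1, σ.symm_apply_apply]
    · rintro rfl
      exact Or.inr ⟨σ.symm j, rfl, by simp⟩
  have hdeg1 : ∀ v, τ v ≠ v → deg P' v = 1 := by
    intro v hv
    obtain ⟨⟨j, x⟩, rfl⟩ : v ∈ Set.range e := by rw [hrange]; exact hv
    cases x
    · rw [deg, hN2, Set.ncard_singleton]
    · rw [deg, hN1, Set.ncard_singleton]
  have hdeg0 : ∀ v, τ v = v → deg P' v = 0 := by
    intro v hv
    have hv' : v ∉ Set.range e := by rw [hrange]; exact fun h => h hv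
    rw [deg, Set.ncard_eq_zero (Set.toFinite _), Set.eq_empty_iff_forall_notMem]
    intro u hu
    rcases (hadj v u).mp hu with ⟨j, rfl, -⟩ | ⟨j, -, rfl⟩ <;> exact hv' ⟨_, rfl⟩
  have hdeg : ∀ v, deg (P ⊔ P') v = deg P v + deg P' v := by
    intro v
    rw [deg, deg, deg, ← Set.ncard_union_eq]
    · congr 1
    · rw [Set.disjoint_left]
      intro u h1 h2
      exact Set.disjoint_left.mp hPH (show s(v, u) ∈ P.edgeSet from h1) (hle h2)
  refine ⟨P', hle, fun v => ?_, fun v => ?_, ?_⟩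
  · by_cases h : τ v = v
    · simp [hdeg0 v h]
    · exact (hdeg1 v h).le
  · rw [hdeg]
    by_cases h : τ v = v
    · rw [hdeg0 v h, hP.deg_of_eq v h]
    · rw [hdeg1 v h, hP.deg_of_ne v h]
  · have hPr : ∀ u v, P.Reachable u v → (P ⊔ P').connectedComponentMk u
        = (P ⊔ P').connectedComponentMk v := fun u v h =>
      SimpleGraph.ConnectedComponent.eq.mpr (h.mono le_sup_left)
    set C : ι → (P ⊔ P').ConnectedComponent := fun j =>
      (P ⊔ P').connectedComponentMk (e (j, true)) with hC
    have hCx : ∀ j x, (P ⊔ P').connectedComponentMk (e (j, x)) = C j := by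
      intro j x
      cases x
      · refine (hPr _ _ (hP.reachable _)).trans ?_
        rw [← hτ]
        rfl
      · rfl
    have hCσ : ∀ j, C (σ j) = C j := by
      intro j
      rw [← hCx (σ j) false]
      refine SimpleGraph.ConnectedComponent.eq.mpr (SimpleGraph.Adj.reachable ?_)
      exact Or.inr ((hadj _ _).mpr (Or.inr ⟨j, rfl, rfl⟩))
    refine Nat.card_le_card_of_surjective (fun z => C (r z)) ?_
    intro c
    induction c using SimpleGraph.ConnectedComponent.ind with
    | _ v =>
    obtain ⟨u, hu, huv⟩ : ∃ u, τ u ≠ u ∧ P.Reachable u v := by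
      by_cases h : τ v = v
      · have h2 : (P.neighborSet v).ncard = 2 := hP.deg_of_eq v h
        obtain ⟨u, hu⟩ : (P.neighborSet v).Nonempty := by
          apply Set.nonempty_of_ncard_ne_zero
          omega
        refine ⟨u, fun h' => ?_, (SimpleGraph.Adj.reachable hu).symm⟩
        exact (SimpleGraph.Adj.ne hu) (hP.eq_of_fixed v u h h')
      · exact ⟨v, h, SimpleGraph.Reachable.refl v⟩
    obtain ⟨⟨j, x⟩, rfl⟩ : u ∈ Set.range e := by rw [hrange]; exact hu
    obtain ⟨z, hz⟩ := hr C hCσ j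
    exact ⟨z, by rw [← hPr _ _ huv, hCx, ← hz]⟩

/-- With `n` large, about `√(r / log n) / 4` classes make random degrees into the classes
concentrate, dominate the discrepancy, and yield few cycles. -/
lemma exists_number_of_classes (n : ℕ) (r d β : ℝ) (hL : 1000000 ≤ Real.log n)
    (hr : 2 * Real.log n ^ 2 ≤ r) (hrd : 29 / 30 * r ≤ d) (hdr : d ≤ r) (hdn : d ≤ n)
    (hβ : β ≤ 2 * √r) :
    ∃ (k : ℕ) (a : ℝ),
      ((n * ((k + 1) * 2) : ℕ) : ℝ)
        * Real.exp (a * Real.log 2 - (29 / 30 * r - 2 * (k + 1)) / (2 * (k + 1)) / 2) < 1 ∧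
      r / n * (((n / 2 / (k + 1) + n / 2 % (k + 1) : ℕ) + 1) / 2) + 4 * β < a ∧
      ((n / 2 / (k + 1) + n / 2 % (k + 1) : ℕ) : ℝ) ≤ 3 * n * √(r * Real.log n) / d := by
  set L := Real.log n with hLdef
  have hL0 : 0 < L := by linarith
  set s := √L with hs
  have hss : s * s = L := Real.mul_self_sqrt hL0.le
  have hs1 : 1000 ≤ s := Real.le_sqrt_of_sq_le (by norm_num; linarith)
  have hr0 : 0 < r := lt_of_lt_of_le (by positivity) hr
  set y := √(r / L) with hy
  have hyy : y * y = r / L := Real.mul_self_sqrt (by positivity)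
  have hry : r = y * y * (s * s) := by rw [hyy, hss]; field_simp
  have hy0 : 0 ≤ y := Real.sqrt_nonneg _
  have hsy : s ≤ y := by
    apply Real.sqrt_le_sqrt
    rw [le_div_iff₀ hL0]
    nlinarith
  have hsr : √r = y * s := by
    rw [hry, show y * y * (s * s) = (y * s) * (y * s) by ring]
    exact Real.sqrt_mul_self (by positivity)
  have hsrL : √(r * L) = y * (s * s) := by
    rw [hry, ← hss, show y * y * (s * s) * (s * s) = (y * (s * s)) * (y * (s * s)) by ring]
    exact Real.sqrt_mul_self (by positivity)
  have hn0 : (0 : ℝ) < n := by linarith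
  have hexp : (n : ℝ) = Real.exp L := (Real.exp_log hn0).symm
  have hyn : y * y ≤ n := by
    rw [hyy, div_le_iff₀ hL0]
    have : (n : ℝ) * 1000000 ≤ n * L := by gcongr
    linarith
  obtain ⟨k, hk⟩ : ∃ k, ⌈y / 4⌉₊ = k + 1 := by
    apply Nat.exists_eq_succ_of_ne_zero
    rw [← Nat.pos_iff_ne_zero, Nat.ceil_pos]
    linarith
  set l : ℝ := (k : ℝ) + 1 with hl
  have hl' : ((⌈y / 4⌉₊ : ℕ) : ℝ) = l := by rw [hk]; push_cast; rfl
  have hl1 : y / 4 ≤ l := by rw [← hl']; exact Nat.le_ceil _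
  have hl2 : l ≤ y / 3 := by
    have := Nat.ceil_lt_add_one (show 0 ≤ y / 4 by linarith)
    linarith
  have hl0 : 0 < l := by linarith
  set R := r / l with hR
  have hRl : R * l = r := by rw [hR]; field_simp
  have hR1 : 3 * (y * (s * s)) ≤ R := by
    rw [hR, le_div_iff₀ hl0, hry]
    have : 3 * (y * (s * s)) * l ≤ 3 * (y * (s * s)) * (y / 3) := by gcongr
    linarith
  have hq : ((n / 2 / (k + 1) : ℕ) : ℝ) ≤ n / (2 * l) := by
    rw [Nat.div_div_eq_div_mul]
    refine (Nat.cast_div_le).trans ?_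
    push_cast
    rfl
  have hw : ((n / 2 % (k + 1) : ℕ) : ℝ) + 1 ≤ l := by
    rw [hl]
    exact_mod_cast Nat.mod_lt _ (Nat.succ_pos k)
  have hμ : (29 / 30 * r - 2 * l) / (2 * l) = 29 / 60 * R - 1 := by
    rw [hR]; field_simp; ring
  have hys : 1000 * (s * s) ≤ y * (s * s) := by
    have : 1000 ≤ y := hs1.trans hsy
    gcongr
  refine ⟨k, 3 / 5 * (29 / 60 * R - 1), ?_, ?_, ?_⟩
  · rw [hμ]
    have hlog := Real.log_two_lt_d9
    have h1 : 3 / 5 * (29 / 60 * R - 1) * Real.log 2 - (29 / 60 * R - 1) / 2 ≤ -(80 * L) := by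
      have h2 : 1000 * L ≤ 29 / 60 * R - 1 := by linarith
      have h3 : (29 / 60 * R - 1) * (3 / 5 * Real.log 2 - 1 / 2)
          ≤ (29 / 60 * R - 1) * (-0.08) := by
        apply mul_le_mul_of_nonneg_left _ (by linarith)
        linarith
      linarith
    have hn2 : (2 : ℝ) ≤ n := by
      rw [hexp]
      linarith [Real.add_one_le_exp L]
    have hyn' : y ≤ n := (le_mul_of_one_le_right hy0 (by linarith)).trans hyn
    have hnn : (n : ℝ) ≤ n * n := le_mul_of_one_le_right hn0.le (by linarith)
    have h4 : ((n * ((k + 1) * 2) : ℕ) : ℝ) ≤ n * (n * n) := by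
      push_cast
      rw [← hl]
      have : l * 2 ≤ (n : ℝ) * n := by linarith
      gcongr
    calc _ ≤ (n * (n * n) : ℝ) * Real.exp (-(80 * L)) := by gcongr
      _ = Real.exp (-(77 * L)) := by
        rw [hexp, ← Real.exp_add, ← Real.exp_add, ← Real.exp_add]
        ring_nf
      _ < 1 := by
        rw [Real.exp_lt_one_iff]
        linarith
  · have h1 : r / n * (((n / 2 / (k + 1) + n / 2 % (k + 1) : ℕ) + 1) / 2)
        ≤ r / n * ((n / (2 * l) + l) / 2) := by
      push_cast
      have : (0 : ℝ) ≤ r / n := by positivity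
      gcongr r / n * (?_ / 2)
      linarith
    have h2 : r / n * ((n / (2 * l) + l) / 2) = R / 4 + r / n * (l / 2) := by
      rw [hR]; field_simp; ring
    have h3 : r / n ≤ 2 := by
      rw [div_le_iff₀ hn0]; linarith
    have h4 : r / n * (l / 2) ≤ 2 * (l / 2) := by gcongr
    rw [hsr] at hβ
    have h5 : 1000 * (y * s) ≤ y * (s * s) := by
      have : 1000 * (y * s) ≤ s * (y * s) := by gcongr
      linarith
    have h6 : y * 1 ≤ y * s := by
      gcongr
      linarith
    linarith
  · have hd0 : 0 < d := by linarith
    have hypos : 0 < y := by linarith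
    rw [hsrL]
    have h1 : 3 * n * (y * (s * s)) / r ≤ 3 * n * (y * (s * s)) / d := by gcongr
    have h2 : 3 * n * (y * (s * s)) / r = 3 * (n / y) := by
      rw [hry]
      have : s ≠ 0 := by linarith
      field_simp
    have h3 : (n : ℝ) / (2 * l) ≤ 2 * (n / y) := by
      calc (n : ℝ) / (2 * l) ≤ n / (2 * (y / 4)) := by gcongr
        _ = _ := by field_simp; norm_num
    have h4 : y ≤ n / y := by rw [le_div_iff₀ hypos]; exact hyn
    push_cast
    linarith

end EDHC

open EDHC in
/-- Lemma 6.7 (PMatchComplete). -/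
theorem stmt_16 :
    ∃ N : ℕ, ∀ n : ℕ, N ≤ n →
      ∀ (rG : ℝ) (G H P : SimpleGraph (Fin n)),
      IsPseudorandom n G (rG / n) → 2 * (Real.log n) ^ 2 ≤ rG →
      H ≤ G → 29 / 30 * rG ≤ (minDeg H : ℝ) →
      (Even n → IsPerfectMatchingGraph P) → (Odd n → IsPerfectPseudomatching P) →
      Disjoint P.edgeSet H.edgeSet →
      ∃ P' : SimpleGraph (Fin n), P' ≤ H ∧ (∀ v, deg P' v ≤ 1) ∧
        (∀ v, deg (P ⊔ P') v = 2) ∧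
        (numCycles (P ⊔ P') : ℝ)
          ≤ 3 * (n : ℝ) * Real.sqrt (rG * Real.log n) / (minDeg H : ℝ) := by
  have hlog : Filter.Tendsto (fun n : ℕ => Real.log n) Filter.atTop Filter.atTop :=
    Real.tendsto_log_atTop.comp tendsto_natCast_atTop_atTop
  obtain ⟨N, hN⟩ := Filter.eventually_atTop.mp (hlog.eventually_ge_atTop 1000000)
  refine ⟨N, fun n hn rG G H P hG hr hHG hHr hPe hPo hPH => ?_⟩
  have hL := hN n hn
  have hn0 : 0 < n := by
    rcases Nat.eq_zero_or_pos n with rfl | h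
    · norm_num at hL
    · exact h
  have : Nonempty (Fin n) := ⟨⟨0, hn0⟩⟩
  have hn0' : (0 : ℝ) < n := by exact_mod_cast hn0
  have hr0 : 0 ≤ rG := le_trans (by positivity) hr
  have hnp : (n : ℝ) * (rG / n) = rG := by field_simp
  obtain ⟨hJ, -, -, ⟨-, hGr, -⟩, -⟩ := hG
  rw [hnp] at hJ hGr
  have hdr : (minDeg H : ℝ) ≤ rG := by
    have h1 : (minDeg H : ℝ) ≤ minDeg G := by exact_mod_cast minDeg_mono hHG
    have h2 := Real.sqrt_nonneg (rG * (1 - rG / n))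
    linarith
  have hdn : (minDeg H : ℝ) ≤ n := by
    have h1 := minDeg_le_deg H ⟨0, hn0⟩
    rw [deg_eq_card_filter] at h1
    have h2 := h1.trans (Finset.card_le_univ _)
    rw [Fintype.card_fin] at h2
    exact_mod_cast h2
  have hβ : 2 * √(rG * (1 - rG / n)) ≤ 2 * √rG := by
    gcongr
    have : 0 ≤ rG / n := by positivity
    nlinarith
  obtain ⟨k, a, ha1, ha2, ha3⟩ :=
    exists_number_of_classes n rG (minDeg H) _ hL hr hHr hdr hdn hβ
  obtain ⟨τ, hτ⟩ : ∃ τ, IsPairing P τ := by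
    rcases Nat.even_or_odd n with h | h
    · exact exists_isPairing_of_matching (hPe h)
    · exact exists_isPairing_of_pseudomatching (hPo h)
  obtain ⟨m, hm, e, he, hrange, heτ⟩ := exists_labelling hτ.invol hτ.eq_of_fixed
  rw [Fintype.card_fin] at hm
  set q := n / 2 / (k + 1) with hq
  set w := n / 2 % (k + 1) with hw
  have E : Fin q × Fin (k + 1) ⊕ Fin w ≃ Fin m := Fintype.equivOfCardEq (by
    simp only [Fintype.card_sum, Fintype.card_prod, Fintype.card_fin, hm, hq, hw]
    exact Nat.div_add_mod' _ _)
  set e₀ : (Fin q × Fin (k + 1) ⊕ Fin w) × Bool → Fin n := fun z => e (E z.1, z.2) with he₀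
  have he₀inj : Function.Injective e₀ := by
    rintro ⟨i, x⟩ ⟨j, y⟩ h
    simpa using he h
  have he₀range : Set.range e₀ = {v | τ v ≠ v} := by
    rw [← hrange]
    ext v
    constructor
    · rintro ⟨z, rfl⟩
      exact ⟨_, rfl⟩
    · rintro ⟨⟨j, x⟩, rfl⟩
      exact ⟨(E.symm j, x), by simp [he₀]⟩
  obtain ⟨e', he', hrange', hτ', hdeg⟩ := exists_balanced_labelling H τ e₀ he₀inj
    (fun j x => heτ _ x)
    (29 / 30 * rG - 2 * (k + 1)) a (by
      intro v
      set B := Finset.univ.filter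
        (fun z : (Fin q × Fin (k + 1)) × Bool => H.Adj v (e₀ (Sum.inl z.1, z.2))) with hB
      have hsub : Finset.univ.filter (H.Adj v) ⊆
          (B.image (fun z => e₀ (Sum.inl z.1, z.2)) ∪
            (Finset.univ : Finset (Fin w × Bool)).image (fun z => e₀ (Sum.inr z.1, z.2))) ∪
            Finset.univ.filter (fun u => τ u = u) := by
        intro u hu
        simp only [Finset.mem_filter, Finset.mem_univ, true_and] at hu
        by_cases h : τ u = u
        · simp [h]
        · obtain ⟨⟨⟨b, i⟩ | t, x⟩, rfl⟩ : u ∈ Set.range e₀ := by rw [he₀range]; exact h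
          · refine Finset.mem_union_left _ (Finset.mem_union_left _ (Finset.mem_image.mpr
              ⟨((b, i), x), ?_, rfl⟩))
            simpa [hB] using hu
          · exact Finset.mem_union_left _ (Finset.mem_union_right _ (Finset.mem_image.mpr
              ⟨(t, x), Finset.mem_univ _, rfl⟩))
      have h1 := (Finset.card_le_card hsub).trans ((Finset.card_union_le _ _).trans
        (Nat.add_le_add_right (Finset.card_union_le _ _) _))
      have h2 : (B.image (fun z => e₀ (Sum.inl z.1, z.2))).card ≤ B.card := Finset.card_image_le
      have h3 : ((Finset.univ : Finset (Fin w × Bool)).image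
          (fun z => e₀ (Sum.inr z.1, z.2))).card ≤ w * 2 := by
        refine Finset.card_image_le.trans ?_
        simp
      have h4 : (Finset.univ.filter (fun u => τ u = u)).card ≤ 1 := by
        rw [Finset.card_le_one]
        intro u hu v hv
        exact hτ.eq_of_fixed u v (by simpa using hu) (by simpa using hv)
      rw [← deg_eq_card_filter] at h1
      have h5 := minDeg_le_deg H v
      have h6 : w < k + 1 := Nat.mod_lt _ (Nat.succ_pos k)
      have h7 : minDeg H ≤ B.card + 2 * (k + 1) := by omega
      have h8 : (minDeg H : ℝ) ≤ B.card + 2 * (k + 1) := by exact_mod_cast h7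
      linarith) (by
      rw [Fintype.card_fin]
      exact ha1)
  obtain ⟨σ, hσ, hσC⟩ := hJ.exists_perm_labels hHG (by positivity) (by positivity) e' he' hdeg ha2
  obtain ⟨P', h1, h2, h3, h4⟩ := hτ.exists_matching hPH e' he' (hrange'.trans he₀range) hτ' σ hσ
    (Sum.map (fun b => (b, 0)) id : Fin q ⊕ Fin w → _) hσC
  refine ⟨P', h1, h2, h3, le_trans ?_ ha3⟩
  rw [Nat.card_eq_fintype_card, Fintype.card_sum, Fintype.card_fin, Fintype.card_fin] at h4
  exact_mod_cast h4
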